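/- Lemma 4.3, second energy estimate (derivative level): For every η ∈ [0,1) and every 𝔱 ∈ (t₀,0): ‖∂ₓv‖²_{L²ₓ}(𝔱) ≤ (∫_{t₀}^{𝔱} ∫_ℝ |t|^η·[ (∂ₓE(t,x))² + (∂ₓ²u_app(t,x))²·v(t,x)² ] dx dt) · exp( ∫_{t₀}^{𝔱} ( 3·‖∂ₓu_app‖_{L∞ₓ}(t) + ν⁻¹·‖v‖²_{L∞ₓ}(t) + 2·|t|^(−η) ) dt ). -/

import Mathlib

open Set MeasureTheory

/-- On a half-open slab, every time slice of a smooth function is smooth. -/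
theorem contDiff_slice {a b : ℝ} {f : ℝ → ℝ → ℝ}
    (hf : ContDiffOn ℝ (⊤ : ℕ∞) (fun p : ℝ × ℝ => f p.1 p.2) (Ico a b ×ˢ (univ : Set ℝ)))
    {t : ℝ} (ht : t ∈ Ico a b) : ContDiff ℝ (⊤ : ℕ∞) (f t) := by
  rw [← contDiffOn_univ]
  exact hf.comp (g := fun p : ℝ × ℝ => f p.1 p.2) (f := fun x : ℝ => (t, x))
    (contDiff_const.prodMk contDiff_id).contDiffOn (fun x _ => ⟨ht, mem_univ x⟩)

/-- The spatial derivative of a smooth function on a half-open slab is smooth on the slab. -/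
theorem contDiffOn_slice_deriv {a b : ℝ} {f : ℝ → ℝ → ℝ}
    (hf : ContDiffOn ℝ (⊤ : ℕ∞) (fun p : ℝ × ℝ => f p.1 p.2) (Ico a b ×ˢ (univ : Set ℝ))) :
    ContDiffOn ℝ (⊤ : ℕ∞) (fun p : ℝ × ℝ => deriv (f p.1) p.2)
      (Ico a b ×ˢ (univ : Set ℝ)) := by
  have hS : UniqueDiffOn ℝ (Ico a b ×ˢ (univ : Set ℝ)) :=
    (uniqueDiffOn_Ico a b).prod uniqueDiffOn_univ
  have h1 := (hf.fderivWithin (m := ((⊤ : ℕ∞) : WithTop ℕ∞)) hS (by simp)).clm_apply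
    (contDiffOn_const (c := ((0 : ℝ), (1 : ℝ))))
  refine h1.congr fun p hp => ?_
  have h2 := ((hf.differentiableOn (by simp)) p hp).hasFDerivWithinAt
  have h3 : HasDerivWithinAt (fun y : ℝ => (p.1, y)) ((0 : ℝ), (1 : ℝ)) univ p.2 :=
    ((hasDerivAt_const p.2 p.1).prodMk (hasDerivAt_id p.2)).hasDerivWithinAt
  have h4 := HasFDerivWithinAt.comp_hasDerivWithinAt (f := fun y : ℝ => (p.1, y)) p.2 h2 h3
    (fun y _ => ⟨hp.1, mem_univ y⟩)
  exact (hasDerivWithinAt_univ.1 h4).deriv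

/-- Mixed partial derivatives of a smooth function on a slab commute at interior times. -/
theorem hasDerivAt_deriv_slice {a b : ℝ} {f : ℝ → ℝ → ℝ}
    (hf : ContDiffOn ℝ (⊤ : ℕ∞) (fun p : ℝ × ℝ => f p.1 p.2) (Ico a b ×ˢ (univ : Set ℝ)))
    {t : ℝ} (ht : t ∈ Ioo a b) (x : ℝ) :
    HasDerivAt (fun s => deriv (f s) x) (deriv (fun y => deriv (fun s => f s y) t) x) t := by
  set F : ℝ × ℝ → ℝ := fun p => f p.1 p.2 with hF
  have hsm : ∀ s ∈ Ioo a b, ∀ y : ℝ, ContDiffAt ℝ (⊤ : ℕ∞) F (s, y) := fun s hs y =>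
    hf.contDiffAt (prod_mem_nhds (Ico_mem_nhds hs.1 hs.2) Filter.univ_mem)
  have hfd : ∀ s ∈ Ioo a b, ∀ y : ℝ, HasFDerivAt F (fderiv ℝ F (s, y)) (s, y) := fun s hs y =>
    ((hsm s hs y).differentiableAt (by simp)).hasFDerivAt
  have hl1 : ∀ s y : ℝ, HasDerivAt (fun y : ℝ => (s, y)) ((0 : ℝ), (1 : ℝ)) y := fun s y =>
    (hasDerivAt_const y s).prodMk (hasDerivAt_id y)
  have hl2 : ∀ s y : ℝ, HasDerivAt (fun s : ℝ => (s, y)) ((1 : ℝ), (0 : ℝ)) s := fun s y =>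
    (hasDerivAt_id s).prodMk (hasDerivAt_const s y)
  have hx : ∀ s ∈ Ioo a b, ∀ y : ℝ, deriv (f s) y = fderiv ℝ F (s, y) (0, 1) := fun s hs y =>
    (HasFDerivAt.comp_hasDerivAt (f := fun y : ℝ => (s, y)) y (hfd s hs y) (hl1 s y)).deriv
  have ht' : ∀ y : ℝ, deriv (fun s => f s y) t = fderiv ℝ F (t, y) (1, 0) := fun y =>
    (HasFDerivAt.comp_hasDerivAt (f := fun s : ℝ => (s, y)) t (hfd t ht y) (hl2 t y)).deriv
  have hD : HasFDerivAt (fderiv ℝ F) (fderiv ℝ (fderiv ℝ F) (t, x)) (t, x) :=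
    (((hsm t ht x).fderiv_right (m := ((⊤ : ℕ∞) : WithTop ℕ∞)) (by simp)).differentiableAt
      (by simp)).hasFDerivAt
  have hsymm : IsSymmSndFDerivAt ℝ F (t, x) :=
    (hsm t ht x).isSymmSndFDerivAt (by
      rw [minSmoothness_of_isRCLikeNormedField]
      exact WithTop.coe_le_coe.2 le_top)
  have e1 : HasDerivAt (fun y => deriv (fun s => f s y) t)
      (fderiv ℝ (fderiv ℝ F) (t, x) (0, 1) (1, 0)) x := by
    rw [funext ht']
    simpa using (HasFDerivAt.comp_hasDerivAt (f := fun y : ℝ => (t, y)) x hD (hl1 t x)).clm_apply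
      (hasDerivAt_const x ((1 : ℝ), (0 : ℝ)))
  have e2 : HasDerivAt (fun s => fderiv ℝ F (s, x) (0, 1))
      (fderiv ℝ (fderiv ℝ F) (t, x) (1, 0) (0, 1)) t := by
    simpa using (HasFDerivAt.comp_hasDerivAt (f := fun s : ℝ => (s, x)) t hD (hl2 t x)).clm_apply
      (hasDerivAt_const t ((0 : ℝ), (1 : ℝ)))
  rw [e1.deriv, hsymm.eq]
  refine e2.congr_of_eventuallyEq ?_
  filter_upwards [Ioo_mem_nhds ht.1 ht.2] with s hs using hx s hs x

/-- A polynomially weighted bound gives decay of order `(1 + x²)⁻¹`, uniformly in time. -/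
theorem exists_decay_bound {s : Set ℝ} {g : ℝ → ℝ → ℝ}
    (h : ∀ k : ℕ, ∃ M : ℝ, ∀ t ∈ s, ∀ x : ℝ, |x| ^ k * |g t x| ≤ M) :
    ∃ C, 0 ≤ C ∧ ∀ t ∈ s, ∀ x, |g t x| ≤ C * (1 + x ^ 2)⁻¹ := by
  obtain ⟨M, hM⟩ := h 0
  obtain ⟨N, hN⟩ := h 2
  refine ⟨|M + N|, abs_nonneg _, fun t ht x => ?_⟩
  rw [← div_eq_mul_inv, le_div_iff₀ (by positivity)]
  have h1 := hM t ht x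
  have h2 := hN t ht x
  rw [sq_abs] at h2
  rw [pow_zero] at h1
  nlinarith [le_abs_self (M + N)]

/-- Continuity of a spatial integral with a uniform decay bound. -/
theorem continuousOn_integral_of_decay {s : Set ℝ} {g : ℝ → ℝ → ℝ} {C : ℝ}
    (hg : ContinuousOn (fun p : ℝ × ℝ => g p.1 p.2) (s ×ˢ (univ : Set ℝ)))
    (hC : ∀ t ∈ s, ∀ x, |g t x| ≤ C * (1 + x ^ 2)⁻¹) :
    ContinuousOn (fun t => ∫ x, g t x) s := by
  refine continuousOn_of_dominated (bound := fun x => C * (1 + x ^ 2)⁻¹) (fun t ht => ?_)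
    (fun t ht => Filter.Eventually.of_forall (hC t ht))
    (integrable_inv_one_add_sq.const_mul C) (Filter.Eventually.of_forall fun x => ?_)
  · refine Continuous.aestronglyMeasurable ?_
    rw [← continuousOn_univ]
    exact hg.comp (f := fun x : ℝ => (t, x)) (by fun_prop) (fun x _ => ⟨ht, mem_univ x⟩)
  · exact hg.comp (f := fun t : ℝ => (t, x)) (by fun_prop) (fun t ht => ⟨ht, mem_univ x⟩)

/-- The spatial supremum of a bounded jointly continuous function is integrable in time,
as is every fixed power of it. -/
theorem integrableOn_iSup_abs_pow {a b M : ℝ} {g : ℝ → ℝ → ℝ}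
    (hg : ContinuousOn (fun p : ℝ × ℝ => g p.1 p.2) (Icc a b ×ˢ (univ : Set ℝ)))
    (hM : ∀ t ∈ Icc a b, ∀ x, |g t x| ≤ M) (n : ℕ) :
    IntegrableOn (fun t => (⨆ x : ℝ, |g t x|) ^ n) (Icc a b) := by
  have hmeas : AEMeasurable (fun t => ⨆ x : ℝ, |g t x|) (volume.restrict (Icc a b)) := by
    refine aemeasurable_restrict_of_measurable_subtype measurableSet_Icc ?_
    refine LowerSemicontinuous.measurable ?_
    refine lowerSemicontinuous_ciSup (fun t => ⟨M, ?_⟩) fun x => ?_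
    · rintro _ ⟨x, rfl⟩
      exact hM t t.2 x
    · have h : ContinuousOn (fun t => g t x) (Icc a b) :=
        hg.comp (f := fun t : ℝ => (t, x)) (by fun_prop) (fun t ht => ⟨ht, mem_univ x⟩)
      exact (continuousOn_iff_continuous_domRestrict.1 h).abs.lowerSemicontinuous
  refine IntegrableOn.of_bound (by simp) (hmeas.pow_const n).aestronglyMeasurable (M ^ n) ?_
  filter_upwards [ae_restrict_mem measurableSet_Icc] with t ht
  have h0 : 0 ≤ ⨆ x : ℝ, |g t x| := Real.iSup_nonneg fun x => abs_nonneg _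
  rw [Real.norm_of_nonneg (pow_nonneg h0 n)]
  exact pow_le_pow_left₀ h0 (ciSup_le (hM t ht)) n

/-- Grönwall's inequality with a merely integrable nonnegative rate. -/
theorem gronwall_of_integrable_rate {a b : ℝ} (hab : a ≤ b) {F F' G α : ℝ → ℝ}
    (hFc : ContinuousOn F (Icc a b)) (hF0 : ∀ t ∈ Icc a b, 0 ≤ F t) (hFa : F a = 0)
    (hGc : ContinuousOn G (Icc a b)) (hG0 : ∀ t ∈ Icc a b, 0 ≤ G t)
    (hα : IntegrableOn α (Icc a b)) (hα0 : ∀ t ∈ Icc a b, 0 ≤ α t)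
    (hF' : ∀ t ∈ Ioo a b, HasDerivAt F (F' t) t)
    (hle : ∀ t ∈ Ioo a b, F' t ≤ G t + α t * F t) :
    F b ≤ (∫ t in a..b, G t) * Real.exp (∫ t in a..b, α t) := by
  have hGi : IntegrableOn G (Icc a b) := hGc.integrableOn_Icc
  have hGii : ∀ s ∈ Icc a b, ∀ t ∈ Icc a b, IntervalIntegrable G volume s t := fun s hs t ht =>
    (hGc.mono (uIcc_subset_Icc hs ht)).intervalIntegrable
  set Γ : ℝ → ℝ := fun t => ∫ s in a..t, G s with hΓ
  have haI : a ∈ Icc a b := left_mem_Icc.2 hab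
  have hbI : b ∈ Icc a b := right_mem_Icc.2 hab
  have hΓc : ContinuousOn Γ (Icc a b) := by
    have := intervalIntegral.continuousOn_primitive_interval (f := G) (μ := volume) (a := a)
      (b := b) (by rwa [uIcc_of_le hab])
    rwa [uIcc_of_le hab] at this
  have hΓle : ∀ t ∈ Icc a b, Γ t ≤ Γ b := by
    intro t ht
    have h1 : Γ b - Γ t = ∫ s in t..b, G s :=
      intervalIntegral.integral_interval_sub_left (hGii a haI b hbI) (hGii a haI t ht)
    have h2 : 0 ≤ ∫ s in t..b, G s := intervalIntegral.integral_nonneg ht.2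
      fun s hs => hG0 s ⟨ht.1.trans hs.1, hs.2⟩
    linarith
  have hΓd : ∀ t ∈ Ioo a b, HasDerivAt Γ (G t) t := by
    intro t ht
    have hn := Icc_mem_nhds ht.1 ht.2
    exact intervalIntegral.integral_hasDerivAt_right (hGii a haI t (Ioo_subset_Icc_self ht))
      (hGc.stronglyMeasurableAtFilter_nhdsWithin measurableSet_Icc t |>.filter_mono
        (by rw [nhdsWithin_eq_nhds.2 hn])) (hGc.continuousAt hn)
  have key : ∀ ε : ℝ, 0 < ε → F b ≤ (Γ b + ε) * Real.exp (∫ t in a..b, α t) := by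
    intro ε hε
    have hpos : ∀ t ∈ Icc a b, 0 < F t + (Γ b - Γ t + ε) := fun t ht => by
      linarith [hF0 t ht, hΓle t ht]
    have hmain := intervalIntegral.sub_le_integral_of_hasDeriv_right_of_le
      (g := fun t => Real.log (F t + (Γ b - Γ t + ε)))
      (g' := fun t => (F' t + (0 - G t)) / (F t + (Γ b - Γ t + ε))) (φ := α) hab
      (ContinuousOn.log (by fun_prop) fun t ht => (hpos t ht).ne')
      (fun t ht => ?_) hα (fun t ht => ?_)
    · have hΓa : Γ a = 0 := intervalIntegral.integral_same
      have hΓ0 : 0 ≤ Γ b := hΓa ▸ hΓle a haI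
      have hb := hpos b hbI
      simp only [hFa, hΓa, sub_zero, sub_self, zero_add] at hmain hb
      have hle2 : Real.log (F b + ε) ≤ Real.log (Γ b + ε) + ∫ t in a..b, α t := by linarith
      have h3 := Real.exp_le_exp.2 hle2
      rw [Real.exp_add, Real.exp_log hb, Real.exp_log (by linarith)] at h3
      linarith
    · have hd := ((hF' t ht).add ((((hasDerivAt_const t (Γ b)).sub (hΓd t ht)).add_const ε)))
      exact (hd.log (hpos t (Ioo_subset_Icc_self ht)).ne').hasDerivWithinAt
    · have htI := Ioo_subset_Icc_self ht
      rw [div_le_iff₀ (hpos t htI)]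
      have := mul_nonneg (hα0 t htI) (by linarith [hΓle t htI] : 0 ≤ Γ b - Γ t + ε)
      nlinarith [hle t ht]
  refine le_of_forall_pos_le_add fun ε hε => ?_
  have h := key (ε / Real.exp (∫ t in a..b, α t)) (by positivity)
  rwa [add_mul, div_mul_cancel₀ _ (Real.exp_pos _).ne'] at h

/-- Pointwise bound for the right-hand side of the differentiated remainder equation. -/
theorem abs_deriv_rhs_le {ν M C u u₁ u₂ v v₁ v₂ v₃ e₁ : ℝ} (hν : 0 < ν)
    (hu : |u| ≤ M) (hu₁ : |u₁| ≤ M) (hu₂ : |u₂| ≤ M)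
    (hv : |v| ≤ C) (hv₁ : |v₁| ≤ C) (hv₂ : |v₂| ≤ C) (hv₃ : |v₃| ≤ C) (he₁ : |e₁| ≤ C) :
    |2 * (-(u₂ * v + 2 * (u₁ * v₁) + u * v₂) - (v₁ * v₁ + v * v₂) + ν * v₃ + e₁)|
      ≤ 2 * (4 * (M * C) + 2 * (C * C) + ν * C + C) := by
  have hmul : ∀ {a b A B : ℝ}, |a| ≤ A → |b| ≤ B → |a * b| ≤ A * B := fun {a b A B} ha hb => by
    rw [abs_mul]
    exact mul_le_mul ha hb (abs_nonneg _) ((abs_nonneg _).trans ha)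
  have h1 := abs_le.1 (hmul hu₂ hv)
  have h2 := abs_le.1 (hmul hu₁ hv₁)
  have h3 := abs_le.1 (hmul hu hv₂)
  have h4 := abs_le.1 (hmul hv₁ hv₁)
  have h5 := abs_le.1 (hmul hv hv₂)
  have h6 := abs_le.1 (hmul (abs_of_pos hν).le hv₃)
  have h7 := abs_le.1 he₁
  rw [abs_le]
  constructor <;> linarith [h1.1, h1.2, h2.1, h2.2, h3.1, h3.2, h4.1, h4.2, h5.1, h5.2, h6.1,
    h6.2, h7.1, h7.2]

/-- The energy inequality for the spatially differentiated remainder equation at a fixed time. -/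
theorem integral_energy_le {ν M C p q U V : ℝ} (hν : 0 < ν) (hp : 0 ≤ p) (hpq : p * q = 1)
    {u u₁ u₂ v v₁ v₂ v₃ e₁ : ℝ → ℝ}
    (hu : ∀ x, HasDerivAt u (u₁ x) x) (hv : ∀ x, HasDerivAt v (v₁ x) x)
    (hv₁ : ∀ x, HasDerivAt v₁ (v₂ x) x) (hv₂ : ∀ x, HasDerivAt v₂ (v₃ x) x)
    (cu₁ : Continuous u₁) (cu₂ : Continuous u₂) (cv₃ : Continuous v₃) (ce₁ : Continuous e₁)
    (bu : ∀ x, |u x| ≤ M) (bu₁ : ∀ x, |u₁ x| ≤ M) (bu₂ : ∀ x, |u₂ x| ≤ M)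
    (bv : ∀ x, |v x| ≤ C * (1 + x ^ 2)⁻¹) (bv₁ : ∀ x, |v₁ x| ≤ C * (1 + x ^ 2)⁻¹)
    (bv₂ : ∀ x, |v₂ x| ≤ C * (1 + x ^ 2)⁻¹) (bv₃ : ∀ x, |v₃ x| ≤ C * (1 + x ^ 2)⁻¹)
    (be₁ : ∀ x, |e₁ x| ≤ C * (1 + x ^ 2)⁻¹)
    (hU : ∀ x, |u₁ x| ≤ U) (hV : ∀ x, |v x| ≤ V) :
    ∫ x, 2 * (-(u₂ x * v x + 2 * (u₁ x * v₁ x) + u x * v₂ x) - (v₁ x * v₁ x + v x * v₂ x)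
        + ν * v₃ x + e₁ x) * v₁ x
      ≤ (∫ x, p * (e₁ x ^ 2 + u₂ x ^ 2 * v x ^ 2))
        + (3 * U + ν⁻¹ * V ^ 2 + 2 * q) * ∫ x, v₁ x ^ 2 := by
  have cu : Continuous u := continuous_iff_continuousAt.2 fun x => (hu x).continuousAt
  have cv : Continuous v := continuous_iff_continuousAt.2 fun x => (hv x).continuousAt
  have cv₁ : Continuous v₁ := continuous_iff_continuousAt.2 fun x => (hv₁ x).continuousAt
  have cv₂ : Continuous v₂ := continuous_iff_continuousAt.2 fun x => (hv₂ x).continuousAt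
  have hC : 0 ≤ C := by simpa using (abs_nonneg _).trans (bv 0)
  have bdd : ∀ {f : ℝ → ℝ}, (∀ x, |f x| ≤ C * (1 + x ^ 2)⁻¹) → ∀ x, |f x| ≤ C := fun hf x =>
    (hf x).trans (mul_le_of_le_one_right hC (inv_le_one_of_one_le₀ (by nlinarith [sq_nonneg x])))
  have int : ∀ {f : ℝ → ℝ}, Continuous f → (∀ x, |f x| ≤ C * (1 + x ^ 2)⁻¹) → Integrable f :=
    fun cf hf => (integrable_inv_one_add_sq.const_mul C).mono' cf.aestronglyMeasurable
      (Filter.Eventually.of_forall hf)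
  have mul : ∀ {f g : ℝ → ℝ} {K : ℝ}, Continuous f → (∀ x, |f x| ≤ K) → Integrable g →
      Integrable fun x => f x * g x := fun cf hf hg =>
    hg.bdd_mul cf.aestronglyMeasurable (Filter.Eventually.of_forall hf)
  have i11 := mul cv₁ (bdd bv₁) (int cv₁ bv₁)
  have i12 := mul cv₁ (bdd bv₁) (int cv₂ bv₂)
  have i13 := mul cv₁ (bdd bv₁) (int cv₃ bv₃)
  have i22 := mul cv₂ (bdd bv₂) (int cv₂ bv₂)
  have iee := mul ce₁ (bdd be₁) (int ce₁ be₁)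
  have ivv := mul cv (bdd bv) (int cv bv)
  set Q : ℝ → ℝ := fun x => 2 * (-(u₂ x * v x + 2 * (u₁ x * v₁ x) + u x * v₂ x)
    - (v₁ x * v₁ x + v x * v₂ x) + ν * v₃ x + e₁ x) * v₁ x with hQ
  set Φ : ℝ → ℝ := fun x => 2 * ν * (v₁ x * v₂ x) - u x * (v₁ x * v₁ x)
    - 2 * (v x * (v₁ x * v₁ x)) with hΦ
  set Φ' : ℝ → ℝ := fun x => 2 * ν * (v₂ x * v₂ x + v₁ x * v₃ x)
    - (u₁ x * (v₁ x * v₁ x) + u x * (2 * (v₁ x * v₂ x)))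
    - 2 * (v₁ x * (v₁ x * v₁ x) + v x * (2 * (v₁ x * v₂ x))) with hΦ'
  have iQ : Integrable Q := mul (by fun_prop) (fun x => abs_deriv_rhs_le hν (bu x) (bu₁ x) (bu₂ x)
    (bdd bv x) (bdd bv₁ x) (bdd bv₂ x) (bdd bv₃ x) (bdd be₁ x)) (int cv₁ bv₁)
  have iΦ : Integrable Φ := ((i12.const_mul (2 * ν)).sub (mul cu bu i11)).sub
    ((mul cv (bdd bv) i11).const_mul 2)
  have iΦ' : Integrable Φ' := (((i22.add i13).const_mul (2 * ν)).sub
    ((mul cu₁ bu₁ i11).add (mul cu bu (i12.const_mul 2)))).sub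
    (((mul cv₁ (bdd bv₁) i11).add (mul cv (bdd bv) (i12.const_mul 2))).const_mul 2)
  have dΦ : ∀ x, HasDerivAt Φ (Φ' x) x := fun x => by
    have h11 := (hv₁ x).mul (hv₁ x)
    have h12 := (hv₁ x).mul (hv₂ x)
    refine (((h12.const_mul (2 * ν)).sub ((hu x).mul h11)).sub
      (((hv x).mul h11).const_mul 2)).congr_deriv ?_
    simp only [hΦ', Pi.mul_apply]
    ring
  have zΦ : ∫ x, Φ' x = 0 := integral_eq_zero_of_hasDerivAt_of_integrable dΦ iΦ' iΦ
  have iR : Integrable fun x => p * (e₁ x ^ 2 + u₂ x ^ 2 * v x ^ 2) := by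
    have := (iee.add (mul cu₂ bu₂ (mul cu₂ bu₂ ivv))).const_mul p
    refine this.congr (Filter.Eventually.of_forall fun x => ?_)
    simp only [Pi.add_apply]
    ring
  have iS : Integrable fun x => (3 * U + ν⁻¹ * V ^ 2 + 2 * q) * v₁ x ^ 2 := by
    simpa only [pow_two] using i11.const_mul (3 * U + ν⁻¹ * (V * V) + 2 * q)
  have hp0 : 0 < p := lt_of_le_of_ne hp (by rintro rfl; simp at hpq)
  have hq : q = p⁻¹ := eq_inv_of_mul_eq_one_right hpq
  have young : ∀ a b : ℝ, 2 * a * b ≤ p * a ^ 2 + q * b ^ 2 := fun a b => by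
    have h : p * a ^ 2 + q * b ^ 2 - 2 * a * b = q * (p * a - b) ^ 2 := by
      rw [hq]; field_simp; ring
    have : 0 ≤ q * (p * a - b) ^ 2 := by rw [hq]; positivity
    linarith
  have ptw : ∀ x, Q x - Φ' x ≤ p * (e₁ x ^ 2 + u₂ x ^ 2 * v x ^ 2)
      + (3 * U + ν⁻¹ * V ^ 2 + 2 * q) * v₁ x ^ 2 := fun x => by
    have h1 := young (e₁ x) (v₁ x)
    have h2 := young (-(u₂ x * v x)) (v₁ x)
    have h3 : -u₁ x * v₁ x ^ 2 ≤ U * v₁ x ^ 2 :=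
      mul_le_mul_of_nonneg_right ((neg_le_abs _).trans (hU x)) (sq_nonneg _)
    have h4 : v x ^ 2 * v₁ x ^ 2 ≤ V ^ 2 * v₁ x ^ 2 :=
      mul_le_mul_of_nonneg_right (sq_le_sq' (abs_le.1 (hV x)).1 (abs_le.1 (hV x)).2)
        (sq_nonneg _)
    have h5 : ν⁻¹ * (v x ^ 2 * v₁ x ^ 2) ≤ ν⁻¹ * (V ^ 2 * v₁ x ^ 2) :=
      mul_le_mul_of_nonneg_left h4 (by positivity)
    have h6 : 2 * (v x * v₁ x * v₂ x) ≤ ν⁻¹ * (v x ^ 2 * v₁ x ^ 2) + 2 * ν * v₂ x ^ 2 := by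
      have h : ν⁻¹ * (v x ^ 2 * v₁ x ^ 2) + 2 * ν * v₂ x ^ 2 - 2 * (v x * v₁ x * v₂ x)
          = ν⁻¹ * (v x * v₁ x - ν * v₂ x) ^ 2 + ν * v₂ x ^ 2 := by
        field_simp; ring
      have : 0 ≤ ν⁻¹ * (v x * v₁ x - ν * v₂ x) ^ 2 + ν * v₂ x ^ 2 := by positivity
      linarith
    have h7 : Q x - Φ' x = 2 * e₁ x * v₁ x + 2 * (-(u₂ x * v x)) * v₁ x
        + 3 * (-u₁ x * v₁ x ^ 2) + 2 * (v x * v₁ x * v₂ x) - 2 * ν * v₂ x ^ 2 := by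
      simp only [hQ, hΦ']
      ring
    rw [h7]
    linarith
  calc ∫ x, Q x = ∫ x, (Q x - Φ' x) := by rw [integral_sub iQ iΦ', zΦ, sub_zero]
    _ ≤ ∫ x, (p * (e₁ x ^ 2 + u₂ x ^ 2 * v x ^ 2)
          + (3 * U + ν⁻¹ * V ^ 2 + 2 * q) * v₁ x ^ 2) :=
        integral_mono (iQ.sub iΦ') (iR.add iS) ptw
    _ = _ := by rw [integral_add iR iS, integral_const_mul, integral_const_mul]

/-- Lemma 4.3, second (derivative-level) energy estimate for the remainder
`v = u^ν - u_app`. -/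
theorem statement19
    (t₀ ν : ℝ) (ht₀ : t₀ < 0) (hν : 0 < ν)
    (uapp E v : ℝ → ℝ → ℝ)
    (huapp_smooth : ContDiffOn ℝ (⊤ : ℕ∞) (fun p : ℝ × ℝ => uapp p.1 p.2)
      (Set.Ico t₀ 0 ×ˢ (Set.univ : Set ℝ)))
    (hE_smooth : ContDiffOn ℝ (⊤ : ℕ∞) (fun p : ℝ × ℝ => E p.1 p.2)
      (Set.Ico t₀ 0 ×ˢ (Set.univ : Set ℝ)))
    (hv_smooth : ContDiffOn ℝ (⊤ : ℕ∞) (fun p : ℝ × ℝ => v p.1 p.2)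
      (Set.Ico t₀ 0 ×ˢ (Set.univ : Set ℝ)))
    (hv_schwartz : ∀ 𝔱 ∈ Set.Ioo t₀ (0:ℝ), ∀ kk nn : ℕ, ∃ M : ℝ,
      ∀ t ∈ Set.Icc t₀ 𝔱, ∀ x : ℝ, |x| ^ kk * |iteratedDeriv nn (v t) x| ≤ M)
    (hE_schwartz : ∀ 𝔱 ∈ Set.Ioo t₀ (0:ℝ), ∀ kk nn : ℕ, ∃ M : ℝ,
      ∀ t ∈ Set.Icc t₀ 𝔱, ∀ x : ℝ, |x| ^ kk * |iteratedDeriv nn (E t) x| ≤ M)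
    (huapp_bdd : ∀ 𝔱 ∈ Set.Ioo t₀ (0:ℝ), ∃ M : ℝ, ∀ t ∈ Set.Icc t₀ 𝔱, ∀ x : ℝ,
      |uapp t x| ≤ M ∧ |deriv (uapp t) x| ≤ M ∧ |deriv (deriv (uapp t)) x| ≤ M)
    (hpde : ∀ t ∈ Set.Ioo t₀ (0:ℝ), ∀ x : ℝ,
      deriv (fun s => v s x) t
        = -(deriv (fun y => uapp t y * v t y) x) - v t x * deriv (v t) x
          + ν * deriv (deriv (v t)) x + E t x)
    (hinit : ∀ x : ℝ, v t₀ x = 0) :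
    ∀ η : ℝ, 0 ≤ η → η < 1 → ∀ 𝔱 ∈ Set.Ioo t₀ (0:ℝ),
      (∫ x : ℝ, (deriv (v 𝔱) x) ^ 2)
        ≤ (∫ t in t₀..𝔱, ∫ x : ℝ,
              |t| ^ η * ((deriv (E t) x) ^ 2 + (deriv (deriv (uapp t)) x) ^ 2 * v t x ^ 2))
          * Real.exp (∫ t in t₀..𝔱,
              (3 * (⨆ x : ℝ, |deriv (uapp t) x|)
                + ν⁻¹ * (⨆ x : ℝ, |v t x|) ^ 2 + 2 * |t| ^ (-η))) := by


  intro η hη0 hη1 T hT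
  have hsub : Icc t₀ T ⊆ Ico t₀ 0 := fun t ht => ⟨ht.1, ht.2.trans_lt hT.2⟩
  have hsub' : Ioo t₀ T ⊆ Ioo t₀ 0 := fun t ht => ⟨ht.1, ht.2.trans hT.2⟩
  have hprod : Icc t₀ T ×ˢ (univ : Set ℝ) ⊆ Ico t₀ 0 ×ˢ univ := prod_mono hsub subset_rfl
  have su₁ := contDiffOn_slice_deriv huapp_smooth
  have su₂ := contDiffOn_slice_deriv (f := fun t => deriv (uapp t)) su₁
  have sv₁ := contDiffOn_slice_deriv hv_smooth
  have sv₂ := contDiffOn_slice_deriv (f := fun t => deriv (v t)) sv₁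
  have sv₃ := contDiffOn_slice_deriv (f := fun t => deriv (deriv (v t))) sv₂
  have se₁ := contDiffOn_slice_deriv hE_smooth
  have slice : ∀ {f : ℝ → ℝ → ℝ},
      ContDiffOn ℝ (⊤ : ℕ∞) (fun p : ℝ × ℝ => f p.1 p.2) (Ico t₀ 0 ×ˢ (univ : Set ℝ)) →
      ∀ t ∈ Icc t₀ T, ∀ x, HasDerivAt (f t) (deriv (f t) x) x := fun hf t ht x =>
    ((contDiff_slice hf (hsub ht)).differentiable (by simp) x).hasDerivAt
  obtain ⟨M, hM⟩ := huapp_bdd T hT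
  have decay : ∃ C, 0 ≤ C ∧ ∀ t ∈ Icc t₀ T, ∀ x, |v t x| ≤ C * (1 + x ^ 2)⁻¹
      ∧ |deriv (v t) x| ≤ C * (1 + x ^ 2)⁻¹ ∧ |deriv (deriv (v t)) x| ≤ C * (1 + x ^ 2)⁻¹
      ∧ |deriv (deriv (deriv (v t))) x| ≤ C * (1 + x ^ 2)⁻¹
      ∧ |deriv (E t) x| ≤ C * (1 + x ^ 2)⁻¹ := by
    obtain ⟨C₀, p₀, h₀⟩ := exists_decay_bound fun k => hv_schwartz T hT k 0
    obtain ⟨C₁, p₁, h₁⟩ := exists_decay_bound fun k => hv_schwartz T hT k 1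
    obtain ⟨C₂, p₂, h₂⟩ := exists_decay_bound fun k => hv_schwartz T hT k 2
    obtain ⟨C₃, p₃, h₃⟩ := exists_decay_bound fun k => hv_schwartz T hT k 3
    obtain ⟨C₄, p₄, h₄⟩ := exists_decay_bound fun k => hE_schwartz T hT k 1
    simp only [iteratedDeriv_succ, iteratedDeriv_zero] at h₀ h₁ h₂ h₃ h₄
    refine ⟨C₀ + C₁ + C₂ + C₃ + C₄, by positivity, fun t ht x => ⟨?_, ?_, ?_, ?_, ?_⟩⟩
    · exact (h₀ t ht x).trans (by gcongr; linarith)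
    · exact (h₁ t ht x).trans (by gcongr; linarith)
    · exact (h₂ t ht x).trans (by gcongr; linarith)
    · exact (h₃ t ht x).trans (by gcongr; linarith)
    · exact (h₄ t ht x).trans (by gcongr; linarith)
  obtain ⟨C, hC, hdec⟩ := decay
  have bdd : ∀ {y : ℝ} (x : ℝ), |y| ≤ C * (1 + x ^ 2)⁻¹ → |y| ≤ C := fun x hy =>
    hy.trans (mul_le_of_le_one_right hC (inv_le_one_of_one_le₀ (by nlinarith [sq_nonneg x])))
  have sqdec : ∀ {y : ℝ} (x : ℝ), |y| ≤ C * (1 + x ^ 2)⁻¹ → y ^ 2 ≤ C * (C * (1 + x ^ 2)⁻¹) :=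
    fun {y} x hy => by
      rw [← sq_abs, pow_two]
      exact mul_le_mul (bdd x hy) hy (abs_nonneg _) hC
  have cv₁ : ContinuousOn (fun p : ℝ × ℝ => deriv (v p.1) p.2) (Icc t₀ T ×ˢ (univ : Set ℝ)) :=
    sv₁.continuousOn.mono hprod
  have cu₂ : ContinuousOn (fun p : ℝ × ℝ => deriv (deriv (uapp p.1)) p.2)
    (Icc t₀ T ×ˢ (univ : Set ℝ)) := su₂.continuousOn.mono hprod
  have ce₁ : ContinuousOn (fun p : ℝ × ℝ => deriv (E p.1) p.2) (Icc t₀ T ×ˢ (univ : Set ℝ)) :=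
    se₁.continuousOn.mono hprod
  have cv : ContinuousOn (fun p : ℝ × ℝ => v p.1 p.2) (Icc t₀ T ×ˢ (univ : Set ℝ)) :=
    hv_smooth.continuousOn.mono hprod
  have cu₁ : ContinuousOn (fun p : ℝ × ℝ => deriv (uapp p.1) p.2)
    (Icc t₀ T ×ˢ (univ : Set ℝ)) := su₁.continuousOn.mono hprod
  set W : ℝ → ℝ → ℝ := fun t x => 2 * (-(deriv (deriv (uapp t)) x * v t x
    + 2 * (deriv (uapp t) x * deriv (v t) x) + uapp t x * deriv (deriv (v t)) x)
    - (deriv (v t) x * deriv (v t) x + v t x * deriv (deriv (v t)) x)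
    + ν * deriv (deriv (deriv (v t))) x + deriv (E t) x) * deriv (v t) x with hW
  have hpt : ∀ t ∈ Ioo t₀ T, ∀ x, HasDerivAt (fun s => deriv (v s) x ^ 2) (W t x) t := by
    intro t ht x
    have htI := Ioo_subset_Icc_self ht
    have h1 := hasDerivAt_deriv_slice hv_smooth (hsub' ht) x
    have h2 : HasDerivAt (fun y => deriv (fun s => v s y) t)
        (-(deriv (deriv (uapp t)) x * v t x
          + 2 * (deriv (uapp t) x * deriv (v t) x) + uapp t x * deriv (deriv (v t)) x)
          - (deriv (v t) x * deriv (v t) x + v t x * deriv (deriv (v t)) x)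
          + ν * deriv (deriv (deriv (v t))) x + deriv (E t) x) x := by
      have e : (fun y => deriv (fun s => v s y) t) = fun y =>
          -(deriv (uapp t) y * v t y + uapp t y * deriv (v t) y) - v t y * deriv (v t) y
            + ν * deriv (deriv (v t)) y + E t y := by
        funext y
        rw [hpde t (hsub' ht) y,
          ((slice huapp_smooth t htI y).fun_mul (slice hv_smooth t htI y)).deriv]
      rw [e]
      have du := slice huapp_smooth t htI x
      have du₁ := slice (f := fun t => deriv (uapp t)) su₁ t htI x
      have dv := slice hv_smooth t htI x
      have dv₁ := slice (f := fun t => deriv (v t)) sv₁ t htI x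
      have dv₂ := slice (f := fun t => deriv (deriv (v t))) sv₂ t htI x
      have de := slice hE_smooth t htI x
      refine (((((du₁.fun_mul dv).fun_add (du.fun_mul dv₁)).fun_neg.fun_sub
        (dv.fun_mul dv₁)).fun_add (dv₂.const_mul ν)).fun_add de).congr_deriv ?_
      ring
    rw [h2.deriv] at h1
    refine (h1.fun_pow 2).congr_deriv ?_
    simp only [hW]
    ring
  have contx : ∀ {f : ℝ → ℝ → ℝ},
      ContDiffOn ℝ (⊤ : ℕ∞) (fun p : ℝ × ℝ => f p.1 p.2) (Ico t₀ 0 ×ˢ (univ : Set ℝ)) →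
      ∀ t ∈ Icc t₀ T, Continuous (f t) := fun hf t ht =>
    (contDiff_slice hf (hsub ht)).continuous
  have hF' : ∀ t ∈ Ioo t₀ T, HasDerivAt (fun t => ∫ x, deriv (v t) x ^ 2) (∫ x, W t x) t := by
    intro t ht
    have htI := Ioo_subset_Icc_self ht
    refine (hasDerivAt_integral_of_dominated_loc_of_deriv_le (𝕜 := ℝ)
      (bound := fun x => 2 * (4 * (M * C) + 2 * (C * C) + ν * C + C) * (C * (1 + x ^ 2)⁻¹))
      (s := Ioo t₀ T) (F' := W) (Ioo_mem_nhds ht.1 ht.2) ?_ ?_ ?_ ?_ ?_ ?_).2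
    · filter_upwards [Ioo_mem_nhds ht.1 ht.2] with s hs
      exact ((contx (f := fun t => deriv (v t)) sv₁ s (Ioo_subset_Icc_self hs)).pow
        2).aestronglyMeasurable
    · refine ((integrable_inv_one_add_sq.const_mul C).const_mul C).mono'
        ((contx (f := fun t => deriv (v t)) sv₁ t htI).pow 2).aestronglyMeasurable
          (Filter.Eventually.of_forall fun x => ?_)
      rw [Real.norm_of_nonneg (sq_nonneg _)]
      exact sqdec x (hdec t htI x).2.1
    · have c1 := contx huapp_smooth t htI
      have c2 := contx (f := fun t => deriv (uapp t)) su₁ t htI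
      have c3 := contx (f := fun t => deriv (deriv (uapp t))) su₂ t htI
      have c4 := contx hv_smooth t htI
      have c5 := contx (f := fun t => deriv (v t)) sv₁ t htI
      have c6 := contx (f := fun t => deriv (deriv (v t))) sv₂ t htI
      have c7 := contx (f := fun t => deriv (deriv (deriv (v t)))) sv₃ t htI
      have c8 := contx (f := fun t => deriv (E t)) se₁ t htI
      refine Continuous.aestronglyMeasurable ?_
      simp only [hW]
      fun_prop
    · refine Filter.Eventually.of_forall fun x s hs => ?_
      have hsI := Ioo_subset_Icc_self hs
      obtain ⟨b0, b1, b2, b3, b4⟩ := hdec s hsI x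
      obtain ⟨m0, m1, m2⟩ := hM s hsI x
      have hb := abs_deriv_rhs_le hν m0 m1 m2 (bdd x b0) (bdd x b1) (bdd x b2) (bdd x b3)
        (bdd x b4)
      rw [Real.norm_eq_abs, hW, abs_mul]
      exact mul_le_mul hb b1 (abs_nonneg _) ((abs_nonneg _).trans hb)
    · exact (integrable_inv_one_add_sq.const_mul C).const_mul _
    · exact Filter.Eventually.of_forall fun x s hs => hpt s hs x
  refine gronwall_of_integrable_rate (F := fun t => ∫ x, deriv (v t) x ^ 2)
    (F' := fun t => ∫ x, W t x) hT.1.le ?_ (fun t _ => integral_nonneg fun x => sq_nonneg _)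
    ?_ ?_ (fun t _ => integral_nonneg fun x => ?_) ?_ (fun t _ => ?_) hF' (fun t ht => ?_)
  · refine continuousOn_integral_of_decay (g := fun t x => deriv (v t) x ^ 2) (C := C * C)
      (cv₁.pow 2) fun t ht x => ?_
    rw [abs_of_nonneg (sq_nonneg _), mul_assoc]
    exact sqdec x (hdec t ht x).2.1
  · have : v t₀ = fun _ => 0 := funext hinit
    simp [this]
  · refine continuousOn_integral_of_decay
      (g := fun t x => |t| ^ η * (deriv (E t) x ^ 2 + deriv (deriv (uapp t)) x ^ 2 * v t x ^ 2))
      (C := |t₀| ^ η * (C * C + M ^ 2 * (C * C))) ?_ fun t ht x => ?_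
    · refine ContinuousOn.mul (Continuous.continuousOn ?_)
        ((ce₁.pow 2).add ((cu₂.pow 2).mul (cv.pow 2)))
      exact (continuous_fst.abs).rpow_const fun _ => Or.inr hη0
    · obtain ⟨b0, b1, b2, b3, b4⟩ := hdec t ht x
      have ht0 : |t| ≤ |t₀| := by
        rw [abs_of_neg (hsub ht).2, abs_of_neg ht₀]
        linarith [ht.1]
      have hm : deriv (deriv (uapp t)) x ^ 2 ≤ M ^ 2 := sq_le_sq' (abs_le.1 (hM t ht x).2.2).1
        (abs_le.1 (hM t ht x).2.2).2
      rw [abs_of_nonneg (by positivity)]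
      calc _ ≤ |t₀| ^ η * (C * (C * (1 + x ^ 2)⁻¹) + M ^ 2 * (C * (C * (1 + x ^ 2)⁻¹))) := by
            gcongr
            · exact sqdec x b4
            · exact sqdec x b0
        _ = _ := by ring
  · positivity
  · have h1 := integrableOn_iSup_abs_pow cu₁ (fun t ht x => (hM t ht x).2.1) 1
    simp only [pow_one] at h1
    have h2 := integrableOn_iSup_abs_pow cv (fun t ht x => bdd x (hdec t ht x).1) 2
    have h3 : IntegrableOn (fun t : ℝ => |t| ^ (-η)) (Icc t₀ T) :=
      (continuous_abs.continuousOn.rpow_const fun t ht =>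
        Or.inl (abs_ne_zero.2 (hsub ht).2.ne)).integrableOn_Icc
    exact ((h1.const_mul 3).add (h2.const_mul ν⁻¹)).add (h3.const_mul 2)
  · have : 0 ≤ ⨆ x : ℝ, |deriv (uapp t) x| := Real.iSup_nonneg fun x => abs_nonneg _
    positivity
  · have htI := Ioo_subset_Icc_self ht
    have habs : 0 < |t| := abs_pos.2 (hsub htI).2.ne
    exact integral_energy_le (M := M) (C := C) hν (by positivity)
      (by rw [← Real.rpow_add habs, add_neg_cancel, Real.rpow_zero])
      (slice huapp_smooth t htI)
      (slice hv_smooth t htI)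
      (slice (f := fun t => deriv (v t)) sv₁ t htI)
      (slice (f := fun t => deriv (deriv (v t))) sv₂ t htI)
      (contx (f := fun t => deriv (uapp t)) su₁ t htI)
      (contx (f := fun t => deriv (deriv (uapp t))) su₂ t htI)
      (contx (f := fun t => deriv (deriv (deriv (v t)))) sv₃ t htI)
      (contx (f := fun t => deriv (E t)) se₁ t htI)
      (fun x => (hM t htI x).1) (fun x => (hM t htI x).2.1) (fun x => (hM t htI x).2.2)
      (fun x => (hdec t htI x).1) (fun x => (hdec t htI x).2.1) (fun x => (hdec t htI x).2.2.1)
      (fun x => (hdec t htI x).2.2.2.1) (fun x => (hdec t htI x).2.2.2.2)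
      (le_ciSup ⟨M, by rintro _ ⟨x, rfl⟩; exact (hM t htI x).2.1⟩)
      (le_ciSup ⟨C, by rintro _ ⟨x, rfl⟩; exact bdd x (hdec t htI x).1⟩)
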